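/- Let D = Π_{k=1}^n [a_k, b_k] with a_k < b_k, and let f : D → ℝⁿ be continuous with each coordinate function f_k monotonically increasing in each of its arguments. Define F_k^- := f_k(b₁,…,b_{k−1}, a_k, b_{k+1},…,b_n) and F_k^+ := f_k(a₁,…,a_{k−1}, b_k, a_{k+1},…,a_n). If F_k^- < F_k^+ for all k, then for every F ∈ Π_{k=1}^n [F_k^-, F_k^+] there exists x ∈ D with f(x) = F. -/

import Mathlib

/-- Vertices of the Freudenthal simplex with base `v` and (inverse) ordering `τ`. -/
def vtx {n K : ℕ} (v : Fin n → Fin (K+1)) (τ : Equiv.Perm (Fin n)) (j : Fin (n+1)) :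
    Fin n → ℕ := fun m => (v m : ℕ) + if (τ m : ℕ) < (j : ℕ) then 1 else 0

lemma vtx_interior {n K : ℕ} (ω : (Fin (n+1) → (Fin (n+1) → ℕ)) → ℤ)
    (v : Fin (n+1) → Fin (K+1)) (i : Fin n) :
    ∑ τ : Equiv.Perm (Fin (n+1)), (Equiv.Perm.sign τ : ℤ) *
      ω (fun l => vtx v τ (i.castSucc.succ.succAbove l)) = 0 := by
  have key : ∀ τ : Equiv.Perm (Fin (n+1)),
      (fun l => vtx v (Equiv.swap i.castSucc i.succ * τ) (i.castSucc.succ.succAbove l)) =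
      (fun l => vtx v τ (i.castSucc.succ.succAbove l)) := by
    intro τ
    funext l m
    have hne : i.castSucc.succ.succAbove l ≠ i.castSucc.succ := Fin.succAbove_ne _ _
    generalize i.castSucc.succ.succAbove l = j at hne
    have hne' : (j : ℕ) ≠ i + 1 := by
      intro h; apply hne; ext; simpa using h
    unfold vtx
    have : ((((Equiv.swap i.castSucc i.succ * τ) m : Fin (n+1)) : ℕ) < (j : ℕ)) ↔
        ((τ m : ℕ) < (j:ℕ)) := by
      rw [Equiv.Perm.mul_apply, Equiv.swap_apply_def]
      split_ifs with h1 h2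
      · rw [h1]; simp; omega
      · rw [h2]; simp; omega
      · rfl
    simp only [this]
  refine Finset.sum_involution (fun τ _ => Equiv.swap i.castSucc i.succ * τ) ?_ ?_ ?_ ?_
  · intro τ _
    rw [key τ, Equiv.Perm.sign_mul, Equiv.Perm.sign_swap (by
      intro h; have := congrArg Fin.val h; simp at this)]
    push_cast; ring
  · intro τ _ _ h
    have h2 : Equiv.swap i.castSucc i.succ = 1 := mul_eq_right.mp h
    rw [Equiv.Perm.one_def, Equiv.swap_eq_refl_iff] at h2
    have := congrArg Fin.val h2
    simp at this
  · intro τ _; simp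
  · intro τ _; simp

lemma vtx_ends {n K : ℕ} (ω : (Fin (n+1) → (Fin (n+1) → ℕ)) → ℤ)
    (h0 : ∀ t, (∃ m, (∀ i, t i m = 0) ∨ ∀ i, t i m = K+1) → ω t = 0) :
    ∑ τ : Equiv.Perm (Fin (n+1)), ∑ v : Fin (n+1) → Fin (K+1),
      (Equiv.Perm.sign τ : ℤ) * ω (fun l => vtx v τ ((0 : Fin (n+2)).succAbove l)) =
    ∑ τ : Equiv.Perm (Fin (n+1)), ∑ v : Fin (n+1) → Fin (K+1),
      (-1)^n * ((Equiv.Perm.sign τ : ℤ) *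
        ω (fun l => vtx v τ ((Fin.last (n+1)).succAbove l))) := by
  rw [← Equiv.sum_comp (Equiv.mulLeft (finRotate (n+1))⁻¹)
    (fun τ => ∑ v : Fin (n+1) → Fin (K+1),
      (-1)^n * ((Equiv.Perm.sign τ : ℤ) *
        ω (fun l => vtx v τ ((Fin.last (n+1)).succAbove l))))]
  refine Finset.sum_congr rfl fun τ _ => ?_
  obtain ⟨m, hm⟩ : ∃ m, τ m = 0 := ⟨τ.symm 0, by simp⟩
  have hsg : ∀ y : ℤ, (-1)^n * ((Equiv.Perm.sign (Equiv.mulLeft (finRotate (n+1))⁻¹ τ) : ℤ) * y)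
      = (Equiv.Perm.sign τ : ℤ) * y := by
    intro y
    have : ((-1 : ℤ))^n * (-1)^n = 1 := by rw [← mul_pow]; simp
    simp only [Equiv.coe_mulLeft, Equiv.Perm.sign_mul, Equiv.Perm.sign_inv, sign_finRotate]
    push_cast
    linear_combination (Equiv.Perm.sign τ : ℤ) * y * this
  simp only [hsg]
  rw [← Equiv.sum_comp (Equiv.addRight (Pi.single m (1 : Fin (K+1))))
    (fun v : Fin (n+1) → Fin (K+1) => (Equiv.Perm.sign τ : ℤ) *
      ω (fun l => vtx v _ ((Fin.last (n+1)).succAbove l)))]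
  refine Finset.sum_congr rfl fun v _ => ?_
  congr 1
  have hrot0 : (finRotate (n+1))⁻¹ 0 = Fin.last n := by
    rw [Equiv.Perm.inv_eq_iff_eq]; simp
  have hrots : ∀ i : Fin n, (finRotate (n+1))⁻¹ i.succ = i.castSucc := by
    intro i
    rw [Equiv.Perm.inv_eq_iff_eq]; simp
  by_cases hv : v m = Fin.last K
  · rw [h0, h0]
    · refine ⟨m, Or.inl fun i => ?_⟩
      simp [vtx, hv, hm, hrot0]
      exact Nat.lt_succ_iff.mp i.2
    · refine ⟨m, Or.inr fun i => ?_⟩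
      simp [vtx, hv, hm]
  · congr 1
    funext l q
    simp only [vtx, Equiv.coe_addRight, Equiv.coe_mulLeft, Pi.add_apply, Equiv.Perm.mul_apply,
      Fin.succAbove_last, Fin.succAbove_zero, Fin.val_castSucc, Fin.val_succ]
    by_cases hq : q = m
    · subst hq
      have : ((v q + 1 : Fin (K+1)) : ℕ) = v q + 1 := Fin.val_add_one_of_lt (Fin.lt_last_iff_ne_last.mpr hv)
      simp [hm, hrot0, this]
      exact Nat.lt_succ_iff.mp l.2
    · have h1 : τ q ≠ 0 := by
        intro h; exact hq (τ.injective (h.trans hm.symm))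
      obtain ⟨i, hi⟩ := Fin.exists_succ_eq.mpr h1
      rw [← hi, hrots]
      simp [Pi.single_eq_of_ne hq]

lemma face_sum {n K : ℕ} (ω : (Fin (n+1) → (Fin (n+1) → ℕ)) → ℤ)
    (h0 : ∀ t, (∃ m, (∀ i, t i m = 0) ∨ ∀ i, t i m = K+1) → ω t = 0) :
    ∑ τ : Equiv.Perm (Fin (n+1)), ∑ v : Fin (n+1) → Fin (K+1), (Equiv.Perm.sign τ : ℤ) *
      ∑ j : Fin (n+2), (-1)^(j : ℕ) * ω (fun l => vtx v τ (j.succAbove l)) = 0 := by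
  simp_rw [Fin.sum_univ_succ (n := n+1), mul_add, Finset.sum_add_distrib, Fin.val_zero, pow_zero,
    one_mul]
  rw [vtx_ends ω h0]
  simp_rw [Fin.sum_univ_castSucc (n := n), mul_add, Finset.sum_add_distrib]
  have : ∑ τ : Equiv.Perm (Fin (n+1)), ∑ v : Fin (n+1) → Fin (K+1), (Equiv.Perm.sign τ : ℤ) *
      ∑ i : Fin n, (-1)^(i.castSucc.succ : ℕ) *
        ω (fun l => vtx v τ (i.castSucc.succ.succAbove l)) = 0 := by
    rw [Finset.sum_comm]
    refine Finset.sum_eq_zero fun v _ => ?_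
    simp_rw [Finset.mul_sum]
    rw [Finset.sum_comm]
    refine Finset.sum_eq_zero fun i _ => ?_
    simp_rw [mul_left_comm]
    rw [← Finset.mul_sum, vtx_interior ω v i, mul_zero]
  rw [this, zero_add, Fin.succ_last]
  simp only [← Finset.sum_add_distrib]
  refine Finset.sum_eq_zero fun τ _ => Finset.sum_eq_zero fun v _ => ?_
  simp only [Fin.val_last, pow_succ]
  ring

/-- Homogeneous coordinate matrix of a list of points under the cochains `c`. -/
def hmat {n N : ℕ} (c : Fin n → (Fin n → ℕ) → ℤ) (s : Fin N → (Fin n → ℕ)) :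
    Matrix (Fin N) (Fin (n+1)) (ℤ) :=
  fun j => Fin.cons 1 (fun i => c i (s j))

/-- Total degree. -/
def tdeg {n : ℕ} (K : ℕ) (c : Fin n → (Fin n → ℕ) → ℤ) : ℤ :=
  ∑ τ : Equiv.Perm (Fin n), ∑ v : Fin n → Fin (K+1),
    (Equiv.Perm.sign τ : ℤ) * (hmat c (vtx v τ)).det

/-- Boundary condition. -/
def Good {n : ℕ} (K : ℕ) (c : Fin n → (Fin n → ℕ) → ℤ) : Prop :=
  ∀ k p, (p k = 0 → c k p = 0) ∧ (p k = K + 1 → c k p = K + 1)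

lemma det_col_const {n : ℕ} (A : Matrix (Fin n) (Fin n) ℤ) (p q : Fin n)
    (hpq : p ≠ q) (hp : ∀ i, A i p = 1) (x : ℤ) (hq : ∀ i, A i q = x) : A.det = 0 := by
  have h1 : A = A.updateCol q (x • fun _ => 1) := by
    ext i j
    by_cases hj : j = q
    · subst hj; simp [hq]
    · simp [hj]
  rw [h1, Matrix.det_updateCol_smul]
  rw [Matrix.det_zero_of_column_eq hpq (fun i => by simp [hp, hpq]), mul_zero]

lemma tdeg_step {n : ℕ} (K : ℕ) (c c' : Fin (n+1) → (Fin (n+1) → ℕ) → ℤ)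
    (hc : Good K c) (hc' : Good K c') (k : Fin (n+1)) (h : ∀ i, i ≠ k → c i = c' i) :
    tdeg K c = tdeg K c' := by
  let E : (Fin (n+1) → (Fin (n+1) → ℕ)) → ℤ := fun t =>
    ((hmat c t).submatrix id k.succ.succAbove).det
  have hcc : ∀ t : Fin (n+1) → (Fin (n+1) → ℕ),
      (hmat c t).submatrix id k.succ.succAbove = (hmat c' t).submatrix id k.succ.succAbove := by
    intro t
    ext i l
    have : k.succ.succAbove l ≠ k.succ := Fin.succAbove_ne _ _
    simp only [Matrix.submatrix_apply, id, hmat]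
    generalize k.succ.succAbove l = q at this
    refine Fin.cases ?_ (fun r hr => ?_) q this
    · intro _; simp
    · simp only [Fin.cons_succ]
      rw [h r (fun e => hr (by rw [e]))]
  let u : (Fin (n+1) → ℕ) → ℤ := fun p => c k p - c' k p
  have hdet : ∀ s : Fin (n+2) → (Fin (n+1) → ℕ), (hmat c s).det =
      (-1)^(k.succ : ℕ) * ∑ j : Fin (n+2), (-1)^(j : ℕ) * (c k (s j) * E (fun l => s (j.succAbove l))) := by
    intro s
    rw [Matrix.det_succ_column _ k.succ, Finset.mul_sum]
    refine Finset.sum_congr rfl fun j _ => ?_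
    rw [pow_add, mul_comm ((-1 : ℤ) ^ (j : ℕ)), mul_assoc, mul_assoc]
    rfl
  have hdet' : ∀ s : Fin (n+2) → (Fin (n+1) → ℕ), (hmat c' s).det =
      (-1)^(k.succ : ℕ) * ∑ j : Fin (n+2), (-1)^(j : ℕ) * (c' k (s j) * E (fun l => s (j.succAbove l))) := by
    intro s
    rw [Matrix.det_succ_column _ k.succ, Finset.mul_sum]
    refine Finset.sum_congr rfl fun j _ => ?_
    rw [pow_add, mul_comm ((-1 : ℤ) ^ (j : ℕ)), mul_assoc, mul_assoc]
    simp only [E, hcc]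
    rfl
  have hE : ∀ s : Fin (n+2) → (Fin (n+1) → ℕ), 
      ∑ j : Fin (n+2), (-1)^(j : ℕ) * E (fun l => s (j.succAbove l)) = 0 := by
    intro s
    have h1 : ((hmat c s).updateCol k.succ (fun _ => 1)).det = 0 := by
      refine det_col_const _ 0 k.succ (Fin.succ_ne_zero k).symm (fun i => ?_) 1 (fun i => ?_)
      · rw [Matrix.updateCol_ne (Fin.succ_ne_zero k).symm]; rfl
      · simp
    rw [Matrix.det_succ_column _ k.succ] at h1
    have h2 : (-1)^(k.succ : ℕ) *
        ∑ j : Fin (n+2), (-1)^(j : ℕ) * E (fun l => s (j.succAbove l)) = 0 := by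
      rw [← h1, Finset.mul_sum]
      refine Finset.sum_congr rfl fun j _ => ?_
      rw [pow_add, Matrix.submatrix_updateCol_succAbove, Matrix.updateCol_self, mul_one,
        mul_comm ((-1 : ℤ) ^ (j : ℕ)) ((-1 : ℤ) ^ (k.succ : ℕ)), mul_assoc]
      rfl
    exact (mul_eq_zero.mp h2).resolve_left (by simp)
  have hsum : ∀ s : Fin (n+2) → (Fin (n+1) → ℕ), (hmat c s).det - (hmat c' s).det =
      - (-1)^(k.succ : ℕ) * ∑ j : Fin (n+2), (-1)^(j : ℕ) *
        (fun t : Fin (n+1) → (Fin (n+1) → ℕ) => (∑ i, u (t i)) * E t)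
        (fun l => s (j.succAbove l)) := by
    intro s
    have h1 : ∀ j : Fin (n+2), (∑ i, u (s (j.succAbove i))) = (∑ i, u (s i)) - u (s j) := by
      intro j
      rw [Fin.sum_univ_succAbove (fun i => u (s i)) j]
      ring
    simp only [h1, sub_mul, mul_sub, Finset.sum_sub_distrib]
    simp_rw [mul_left_comm _ (∑ i, u (s i))]
    rw [← Finset.mul_sum, hE, hdet, hdet', ← mul_sub, ← Finset.sum_sub_distrib]
    rw [mul_zero, mul_zero, zero_sub, neg_mul, neg_neg]
    congr 1
    refine Finset.sum_congr rfl fun j _ => ?_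
    simp only [u]; ring
  have h00 : tdeg K c - tdeg K c' = 0 := by
    unfold tdeg
    simp only [← Finset.sum_sub_distrib, ← mul_sub, hsum]
    have hrw : ∀ A B : ℤ, A * (- (-1)^(k.succ : ℕ) * B) = - (-1)^(k.succ : ℕ) * (A * B) :=
      fun A B => by ring
    simp only [hrw]
    rw [Finset.sum_congr rfl (fun τ _ => (Finset.mul_sum _ _ _).symm), ← Finset.mul_sum]
    refine mul_eq_zero_of_right _ ?_
    refine face_sum (K := K) (fun t => (∑ i, u (t i)) * E t) ?_
    rintro t ⟨m, hm⟩
    obtain ⟨x, hx, hx'⟩ : ∃ x : ℤ, (∀ i, c m (t i) = x) ∧ (∀ i, c' m (t i) = x) := by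
      rcases hm with hm | hm
      · exact ⟨0, fun i => (hc m _).1 (hm i), fun i => (hc' m _).1 (hm i)⟩
      · exact ⟨K+1, fun i => (hc m _).2 (hm i), fun i => (hc' m _).2 (hm i)⟩
    by_cases hmk : m = k
    · subst hmk
      have : ∀ i, u (t i) = 0 := fun i => by
        simp [u, hx, hx']
      simp [this]
    · have : E t = 0 := by
        obtain ⟨p, hp⟩ := Fin.exists_succAbove_eq (y := k.succ) (x := 0) (Fin.succ_ne_zero k).symm
        obtain ⟨q, hq⟩ := Fin.exists_succAbove_eq (y := k.succ) (x := m.succ)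
          (fun e => hmk (Fin.succ_injective _ e))
        refine det_col_const _ p q ?_ (fun i => ?_) x (fun i => ?_)
        · rintro rfl
          rw [hp] at hq
          exact (Fin.succ_ne_zero m) hq.symm
        · simp [hp, hmat]
        · simp [hq, hmat, hx]
      simp [this]
  exact sub_eq_zero.mp h00

/-- Linear comparison cochain. -/
def lin {n : ℕ} : Fin n → (Fin n → ℕ) → ℤ := fun k p => (p k : ℤ)

lemma tdeg_eq_lin {n : ℕ} (K : ℕ) (c : Fin (n+1) → (Fin (n+1) → ℕ) → ℤ)
    (hc : Good K c) : tdeg K c = tdeg K (lin : Fin (n+1) → _) := by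
  have hl : Good K (lin : Fin (n+1) → (Fin (n+1) → ℕ) → ℤ) := by
    intro k p
    refine ⟨fun h => by simp [lin, h], fun h => by simp [lin, h]⟩
  have hg : ∀ S : Finset (Fin (n+1)), Good K (fun k => if k ∈ S then lin k else c k) := by
    intro S k p
    by_cases hk : k ∈ S
    · simpa [hk] using hl k p
    · simpa [hk] using hc k p
  have : ∀ S : Finset (Fin (n+1)), tdeg K c = tdeg K (fun k => if k ∈ S then lin k else c k) := by
    intro S
    induction S using Finset.induction_on with
    | empty => simp
    | insert k S hk ih =>
      rw [ih]
      refine tdeg_step K _ _ (hg _) (hg _) k (fun i hi => ?_)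
      simp [hi]
  simpa using this Finset.univ


lemma det_lin {n K : ℕ} (v : Fin n → Fin (K+1)) (τ : Equiv.Perm (Fin n)) :
    (hmat lin (vtx v τ)).det = (Equiv.Perm.sign τ : ℤ) := by
  let L : Matrix (Fin (n+1)) (Fin (n+1)) ℤ := fun j l => if l ≤ j then 1 else 0
  have hL : L.det = 1 := by
    rw [Matrix.det_of_isLowerTriangular]
    · simp [L]
    · intro i j hij
      have : i < j := hij
      simp [L, this]
  let e := Equiv.Perm.decomposeFin.symm ((0 : Fin (n+1)), τ)
  have he : (L.submatrix id e).det = (Equiv.Perm.sign τ : ℤ) := by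
    rw [Matrix.det_permute', hL, mul_one]
    simp [e, Equiv.Perm.decomposeFin.symm_sign]
  rw [← he, ← Matrix.det_transpose, ← Matrix.det_transpose (L.submatrix id e)]
  refine Matrix.det_eq_of_forall_row_eq_smul_add_const
    (Fin.cons 0 (fun m => ((v m : ℕ) : ℤ))) 0 (by simp) (fun i j => ?_)
  refine Fin.cases ?_ (fun m => ?_) i
  · rw [Matrix.transpose_apply, Matrix.transpose_apply, Matrix.submatrix_apply]
    simp [hmat, L, e]
  · rw [Matrix.transpose_apply, Matrix.transpose_apply, Matrix.transpose_apply,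
      Matrix.submatrix_apply, Matrix.submatrix_apply]
    simp only [hmat, L, e, lin, vtx, Fin.le_def, Fin.cons_succ, id,
      Equiv.Perm.decomposeFin_symm_apply_succ, Equiv.Perm.decomposeFin_symm_apply_zero,
      Equiv.swap_self, Equiv.refl_apply, Fin.val_succ, Nat.succ_le_iff]
    push_cast
    simp
    ring

lemma tdeg_lin {n : ℕ} (K : ℕ) : tdeg K (lin : Fin n → _) ≠ 0 := by
  unfold tdeg
  have : ∀ τ : Equiv.Perm (Fin n), (Equiv.Perm.sign τ : ℤ) * (Equiv.Perm.sign τ : ℤ) = 1 := by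
    intro τ
    rw [← Units.val_mul, Int.units_mul_self]; rfl
  simp only [det_lin, this]
  simp
  intro h
  exfalso; omega

lemma discrete {n : ℕ} (K : ℕ) (c : Fin (n+1) → (Fin (n+1) → ℕ) → ℤ)
    (hc : Good K c) (hv : ∀ k p, c k p = 0 ∨ c k p = K + 1) :
    ∃ (v : Fin (n+1) → Fin (K+1)) (τ : Equiv.Perm (Fin (n+1))), ∀ k,
      (∃ j, c k (vtx v τ j) = 0) ∧ (∃ j, c k (vtx v τ j) = K + 1) := by
  have h := tdeg_lin (n := n+1) K
  rw [← tdeg_eq_lin K c hc] at h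
  obtain ⟨τ, -, h⟩ := Finset.exists_ne_zero_of_sum_ne_zero h
  obtain ⟨v, -, h⟩ := Finset.exists_ne_zero_of_sum_ne_zero h
  have hd : (hmat c (vtx v τ)).det ≠ 0 := right_ne_zero_of_mul h
  refine ⟨v, τ, fun k => ⟨?_, ?_⟩⟩
  · by_contra! hcon
    exact hd (det_col_const _ 0 k.succ (Fin.succ_ne_zero k).symm (fun i => rfl) (K+1)
      (fun i => (hv k _).resolve_left (hcon i)))
  · by_contra! hcon
    exact hd (det_col_const _ 0 k.succ (Fin.succ_ne_zero k).symm (fun i => rfl) 0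
      (fun i => (hv k _).resolve_right (hcon i)))


lemma miranda_step {n : ℕ} (a b : Fin (n+1) → ℝ) (hab : ∀ k, a k < b k)
    (g : (Fin (n+1) → ℝ) → (Fin (n+1) → ℝ))
    (hlo : ∀ k, ∀ x ∈ Set.univ.pi fun k => Set.Icc (a k) (b k), x k = a k → g x k ≤ 0)
    (hhi : ∀ k, ∀ x ∈ Set.univ.pi fun k => Set.Icc (a k) (b k), x k = b k → 0 ≤ g x k)
    (K : ℕ) :
    ∃ x ∈ Set.univ.pi fun k => Set.Icc (a k) (b k), ∀ k,
      (∃ y ∈ Set.univ.pi fun k => Set.Icc (a k) (b k),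
        (∀ m, |y m - x m| ≤ (b m - a m) * (1 / ((K : ℝ) + 1))) ∧ g y k ≤ 0) ∧
      (∃ y ∈ Set.univ.pi fun k => Set.Icc (a k) (b k),
        (∀ m, |y m - x m| ≤ (b m - a m) * (1 / ((K : ℝ) + 1))) ∧ 0 ≤ g y k) := by
  have hK : (0 : ℝ) < (K : ℝ) + 1 := by positivity
  let pt : (Fin (n+1) → ℕ) → (Fin (n+1) → ℝ) := fun p k =>
    a k + (b k - a k) * ((p k : ℝ) / ((K : ℝ) + 1))
  have hpt : ∀ p : Fin (n+1) → ℕ, (∀ m, p m ≤ K + 1) →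
      pt p ∈ Set.univ.pi fun k => Set.Icc (a k) (b k) := by
    intro p hp m _
    have h1 : (p m : ℝ) / ((K : ℝ) + 1) ≤ 1 := by
      rw [div_le_one hK]; exact_mod_cast hp m
    have h2 : 0 ≤ (p m : ℝ) / ((K : ℝ) + 1) := by positivity
    have h3 := hab m
    simp only [pt]
    constructor <;> nlinarith
  let c : Fin (n+1) → (Fin (n+1) → ℕ) → ℤ := fun k p =>
    if p k = 0 then 0 else if p k = K + 1 then K + 1 else if 0 ≤ g (pt p) k then K + 1 else 0
  have hc : Good K c := by
    intro k p
    refine ⟨fun h => by simp [c, h], fun h => by simp [c, h]⟩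
  have hv : ∀ k p, c k p = 0 ∨ c k p = K + 1 := by
    intro k p
    simp only [c]
    split_ifs <;> simp
  have hK1 : (K : ℤ) + 1 ≠ 0 := by positivity
  have hc0 : ∀ k p, (∀ m, p m ≤ K + 1) → c k p = 0 → g (pt p) k ≤ 0 := by
    intro k p hp h
    simp only [c] at h
    split_ifs at h with h1 h2 h3
    · exact hlo k _ (hpt p hp) (by simp [pt, h1])
    · exact absurd h hK1
    · exact absurd h hK1
    · exact (not_le.mp h3).le
  have hc1 : ∀ k p, (∀ m, p m ≤ K + 1) → c k p = K + 1 → 0 ≤ g (pt p) k := by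
    intro k p hp h
    simp only [c] at h
    split_ifs at h with h1 h2 h3
    · exact absurd h.symm hK1
    · refine hhi k _ (hpt p hp) ?_
      simp only [pt, h2]
      push_cast
      rw [div_self hK.ne']; ring
    · exact h3
    · exact absurd h.symm hK1
  obtain ⟨v, τ, h⟩ := discrete K c hc hv
  have hvt : ∀ j m, vtx v τ j m ≤ K + 1 := by
    intro j m
    have := (v m).2
    simp only [vtx]; split_ifs <;> omega
  have hd : ∀ j m, |pt (vtx v τ j) m - pt (fun m => (v m : ℕ)) m| ≤
      (b m - a m) * (1 / ((K : ℝ) + 1)) := by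
    intro j m
    have h3 : 0 < (b m - a m) * (1 / ((K : ℝ) + 1)) :=
      mul_pos (sub_pos.mpr (hab m)) (by positivity)
    simp only [pt, vtx]
    split_ifs
    · push_cast
      have : a m + (b m - a m) * ((((v m : ℕ) : ℝ) + 1) / ((K : ℝ) + 1)) -
        (a m + (b m - a m) * (((v m : ℕ) : ℝ) / ((K : ℝ) + 1))) =
          (b m - a m) * (1 / ((K : ℝ) + 1)) := by ring
      rw [this, abs_of_pos h3]
    · simp only [add_zero, sub_self, abs_zero]; exact h3.le
  refine ⟨pt (fun m => (v m : ℕ)), hpt _ (fun m => by have := (v m).2; omega), fun k => ?_⟩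
  obtain ⟨⟨j, hj⟩, ⟨j', hj'⟩⟩ := h k
  exact ⟨⟨_, hpt _ (hvt j), hd j, hc0 k _ (hvt j) hj⟩,
    ⟨_, hpt _ (hvt j'), hd j', hc1 k _ (hvt j') hj'⟩⟩

lemma miranda {n : ℕ} (a b : Fin (n+1) → ℝ) (hab : ∀ k, a k < b k)
    (g : (Fin (n+1) → ℝ) → (Fin (n+1) → ℝ))
    (hg : ContinuousOn g (Set.univ.pi fun k => Set.Icc (a k) (b k)))
    (hlo : ∀ k, ∀ x ∈ Set.univ.pi fun k => Set.Icc (a k) (b k), x k = a k → g x k ≤ 0)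
    (hhi : ∀ k, ∀ x ∈ Set.univ.pi fun k => Set.Icc (a k) (b k), x k = b k → 0 ≤ g x k) :
    ∃ x ∈ Set.univ.pi fun k => Set.Icc (a k) (b k), ∀ k, g x k = 0 := by
  have hcomp : IsCompact (Set.univ.pi fun k => Set.Icc (a k) (b k)) :=
    isCompact_univ_pi fun k => isCompact_Icc
  choose x hxD hx using miranda_step a b hab g hlo hhi
  obtain ⟨x₀, hx₀, φ, hφ, hlim⟩ := hcomp.tendsto_subseq hxD
  have hlim' : ∀ y : ℕ → (Fin (n+1) → ℝ),
      (∀ K, y K ∈ Set.univ.pi fun k => Set.Icc (a k) (b k)) →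
      (∀ K m, |y K m - x K m| ≤ (b m - a m) * (1 / ((K : ℝ) + 1))) → ∀ k,
      Filter.Tendsto (fun i => g (y (φ i)) k) Filter.atTop (nhds (g x₀ k)) := by
    intro y hyD hy k
    have h1 : Filter.Tendsto (fun i => y (φ i)) Filter.atTop (nhds x₀) := by
      rw [tendsto_pi_nhds] at hlim ⊢
      intro m
      have h2 : Filter.Tendsto (fun K : ℕ => y K m - x K m) Filter.atTop (nhds 0) := by
        refine squeeze_zero_norm (fun K => hy K m) ?_
        simpa using (tendsto_one_div_add_atTop_nhds_zero_nat (𝕜 := ℝ)).const_mul (b m - a m)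
      have h3 := (h2.comp hφ.tendsto_atTop).add (hlim m)
      simpa using h3
    have h4 : Filter.Tendsto (fun i => g (y (φ i))) Filter.atTop (nhds (g x₀)) :=
      (hg x₀ hx₀).tendsto.comp (tendsto_nhdsWithin_iff.mpr
        ⟨h1, Filter.Eventually.of_forall fun i => hyD (φ i)⟩)
    exact (tendsto_pi_nhds.mp h4) k
  refine ⟨x₀, hx₀, fun k => le_antisymm ?_ ?_⟩
  · choose y hyD hy hgy using fun K => (hx K k).1
    exact le_of_tendsto' (hlim' y hyD hy k) (fun i => hgy _)
  · choose y hyD hy hgy using fun K => (hx K k).2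
    exact ge_of_tendsto' (hlim' y hyD hy k) (fun i => hgy _)


/-- Multi-dimensional intermediate value theorem (Lemma 3.5 of [HKP97]).
If `f : D → ℝⁿ` is continuous on the box `D = Π_k [a_k, b_k]`, each coordinate `f_k`
is nondecreasing in each argument, and
`F_k⁻ := f_k(b₁,…,b_{k−1},a_k,b_{k+1},…,b_n) < F_k⁺ := f_k(a₁,…,a_{k−1},b_k,a_{k+1},…,a_n)`,
then every `F ∈ Π_k [F_k⁻, F_k⁺]` is attained: `f(x) = F` for some `x ∈ D`. -/
theorem stmt14 (n : ℕ) (a b : Fin n → ℝ) (hab : ∀ k, a k < b k)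
    (f : (Fin n → ℝ) → (Fin n → ℝ))
    (hf : ContinuousOn f (Set.univ.pi fun k => Set.Icc (a k) (b k)))
    (hmono : ∀ k : Fin n, ∀ x ∈ Set.univ.pi fun k => Set.Icc (a k) (b k),
      ∀ y ∈ Set.univ.pi fun k => Set.Icc (a k) (b k),
        (∀ i, x i ≤ y i) → f x k ≤ f y k)
    (hF : ∀ k, f (Function.update b k (a k)) k < f (Function.update a k (b k)) k)
    (F : Fin n → ℝ)
    (hFin : ∀ k, F k ∈ Set.Icc (f (Function.update b k (a k)) k)
      (f (Function.update a k (b k)) k)) :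
    ∃ x ∈ Set.univ.pi fun k => Set.Icc (a k) (b k), f x = F := by
  cases n with
  | zero => exact ⟨fun i => i.elim0, fun i => i.elim0, funext fun i => i.elim0⟩
  | succ n =>
    suffices hM : ∃ x ∈ Set.univ.pi fun k => Set.Icc (a k) (b k), ∀ k, f x k - F k = 0 by
      obtain ⟨x, hx, h⟩ := hM
      exact ⟨x, hx, funext fun k => sub_eq_zero.mp (h k)⟩
    refine miranda a b hab (fun x k => f x k - F k) (hf.sub continuousOn_const) ?_ ?_
    · intro k x hx hxk
      have h1 := hmono k x hx (Function.update b k (a k)) (by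
        intro i _
        by_cases hi : i = k
        · subst hi; simpa using (hab i).le
        · simpa [hi] using (hab i).le) (by
        intro i
        by_cases hi : i = k
        · subst hi; simp [hxk]
        · simpa [hi] using (hx i trivial).2)
      have h2 := (hFin k).1
      simp only [sub_nonpos]
      linarith
    · intro k x hx hxk
      have h1 := hmono k (Function.update a k (b k)) (by
        intro i _
        by_cases hi : i = k
        · subst hi; simpa using (hab i).le
        · simpa [hi] using (hab i).le) x hx (by
        intro i
        by_cases hi : i = k
        · subst hi; simp [hxk]
        · simpa [hi] using (hx i trivial).1)
      have h2 := (hFin k).2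
      simp only [sub_nonneg]
      linarith
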